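/- arXiv:2303.12200 — 2 statements merged into one kernel-verified Lean document; each statement's English description precedes it below -/
import Mathlib

section
/- Let n ≥ 2 and let f : ℝⁿ → ℝ be a smooth function such that: f is harmonic on the open slab {x ∈ ℝⁿ : 0 < xₙ < 2}; f(x) ≥ 0 for every x with 0 ≤ xₙ ≤ 2; f(x) = 0 for every x with xₙ = 0 or xₙ = 2; and sup{‖∇f(x)‖ : x ∈ ℝⁿ, xₙ = 0} < ∞. Then f(x) = 0 for every x with 0 ≤ xₙ ≤ 2. -/
open MeasureTheory Set

/-- The Laplacian `Δf = Σᵢ ∂²f/∂xᵢ²` of a function on Euclidean space. -/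
noncomputable def laplacian {n : ℕ} (f : EuclideanSpace ℝ (Fin n) → ℝ)
    (x : EuclideanSpace ℝ (Fin n)) : ℝ :=
  ∑ i : Fin n,
    fderiv ℝ (fun y => fderiv ℝ f y (EuclideanSpace.single i 1)) x (EuclideanSpace.single i 1)

/-- Product test function. -/
noncomputable def slabPhi {N : ℕ} (p : Fin N → ℝ → ℝ) (y : Fin N → ℝ) : ℝ := ∏ j, p j (y j)

lemma slabPhi_update {N : ℕ} (p : Fin N → ℝ → ℝ) (i : Fin N) (g : ℝ → ℝ) (y : Fin N → ℝ) :
    slabPhi (Function.update p i g) y = g (y i) * ∏ j ∈ Finset.univ.erase i, p j (y j) := by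
  unfold slabPhi
  rw [← Finset.mul_prod_erase _ _ (Finset.mem_univ i)]
  congr 1
  · simp
  · refine Finset.prod_congr rfl fun j hj => ?_
    rw [Function.update_of_ne (Finset.ne_of_mem_erase hj)]

lemma slabPhi_eq {N : ℕ} (p : Fin N → ℝ → ℝ) (i : Fin N) (y : Fin N → ℝ) :
    slabPhi p y = p i (y i) * ∏ j ∈ Finset.univ.erase i, p j (y j) := by
  have := slabPhi_update p i (p i) y
  rwa [Function.update_eq_self] at this

lemma slabPhi_continuous {N : ℕ} {p : Fin N → ℝ → ℝ} (h : ∀ i, Continuous (p i)) :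
    Continuous (slabPhi p) := by
  unfold slabPhi
  exact continuous_finsetProd _ fun j _ => (h j).comp (continuous_apply j)

lemma slabPhi_differentiable {N : ℕ} {p : Fin N → ℝ → ℝ} (h : ∀ i, Differentiable ℝ (p i)) :
    Differentiable ℝ (slabPhi p) := by
  unfold slabPhi
  intro y
  exact (HasFDerivAt.finsetProd (u := Finset.univ)
    (fun j _ => ((h j).comp (differentiable_apply j) y).hasFDerivAt)).differentiableAt

lemma slabPhi_fderiv {N : ℕ} {p : Fin N → ℝ → ℝ} (h : ∀ i, Differentiable ℝ (p i))
    (i : Fin N) {g : ℝ → ℝ} (hg : ∀ t, HasDerivAt (p i) (g t) t) (y : Fin N → ℝ) :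
    fderiv ℝ (slabPhi p) y (Pi.single i 1) = slabPhi (Function.update p i g) y := by
  have h1 : HasDerivAt (fun t => slabPhi p (Function.update y i t))
      (fderiv ℝ (slabPhi p) y (Pi.single i 1)) (y i) := by
    have h2 := hasDerivAt_update y i (y i)
    have h3 : HasFDerivAt (slabPhi p) (fderiv ℝ (slabPhi p) y) (Function.update y i (y i)) := by
      rw [Function.update_eq_self]
      exact (slabPhi_differentiable h y).hasFDerivAt
    exact h3.comp_hasDerivAt (y i) h2
  have h4 : HasDerivAt (fun t => slabPhi p (Function.update y i t))
      (slabPhi (Function.update p i g) y) (y i) := by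
    rw [slabPhi_update]
    have : (fun t => slabPhi p (Function.update y i t)) =
        fun t => p i t * ∏ j ∈ Finset.univ.erase i, p j (y j) := by
      funext t
      rw [slabPhi_eq p i]
      congr 1
      · simp
      · refine Finset.prod_congr rfl fun j hj => ?_
        rw [Function.update_of_ne (Finset.ne_of_mem_erase hj)]
    rw [this]
    exact (hg (y i)).mul_const _
  exact h1.unique h4

/-- Lower corner of the box. -/
noncomputable def slabLo (m : ℕ) (R : ℝ) : Fin (m + 1) → ℝ :=
  fun i => if i = Fin.last m then 0 else -R

/-- Upper corner of the box. -/
noncomputable def slabHi (m : ℕ) (R : ℝ) : Fin (m + 1) → ℝ :=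
  fun i => if i = Fin.last m then 2 else R

lemma slab_green {m : ℕ} {F : (Fin (m + 1) → ℝ) → ℝ} (hF : ContDiff ℝ 2 F)
    (hharm : ∀ y : Fin (m + 1) → ℝ, 0 < y (Fin.last m) → y (Fin.last m) < 2 →
      ∑ i, fderiv ℝ (fun z => fderiv ℝ F z (Pi.single i 1)) y (Pi.single i 1) = 0)
    (hzero : ∀ y : Fin (m + 1) → ℝ, y (Fin.last m) = 0 ∨ y (Fin.last m) = 2 → F y = 0)
    {p p' p'' : Fin (m + 1) → ℝ → ℝ} (hp : ∀ i t, HasDerivAt (p i) (p' i t) t)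
    (hp' : ∀ i t, HasDerivAt (p' i) (p'' i t) t) (hc : ∀ i, Continuous (p'' i))
    {R : ℝ} (hR : 0 < R)
    (side : ∀ i, i ≠ Fin.last m → p i R = 0 ∧ p i (-R) = 0 ∧ p' i R = 0 ∧ p' i (-R) = 0)
    (top : p (Fin.last m) 2 = 0) :
    ∫ y in Icc (slabLo m R) (slabHi m R), F y * ∑ i, slabPhi (Function.update p i (p'' i)) y =
      ∫ x in Icc (slabLo m R ∘ (Fin.last m).succAbove) (slabHi m R ∘ (Fin.last m).succAbove),
        slabPhi p ((Fin.last m).insertNth 0 x) *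
          fderiv ℝ F ((Fin.last m).insertNth 0 x) (Pi.single (Fin.last m) 1) := by
  have hpd : ∀ i, Differentiable ℝ (p i) := fun i t => (hp i t).differentiableAt
  have hpd' : ∀ i, Differentiable ℝ (p' i) := fun i t => (hp' i t).differentiableAt
  have hupd : ∀ i j, Differentiable ℝ (Function.update p i (p' i) j) := by
    intro i j
    rcases eq_or_ne j i with rfl | h
    · simpa using hpd' j
    · simpa [h] using hpd j
  have hupd2 : ∀ i j, Continuous (Function.update p i (p'' i) j) := by
    intro i j
    rcases eq_or_ne j i with rfl | h
    · simpa using hc j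
    · simpa [h] using (hpd j).continuous
  have hFd : Differentiable ℝ F := hF.differentiable (by norm_num)
  have hD : ∀ i : Fin (m + 1), ContDiff ℝ 1 (fun z => fderiv ℝ F z (Pi.single i 1)) := by
    intro i
    exact (hF.fderiv_right (m := 1) (by norm_num)).clm_apply contDiff_const
  have hDd : ∀ i : Fin (m + 1), Differentiable ℝ (fun z => fderiv ℝ F z (Pi.single i 1)) :=
    fun i => (hD i).differentiable (by norm_num)
  have hDDc : ∀ i : Fin (m + 1), Continuous
      (fun y => fderiv ℝ (fun z => fderiv ℝ F z (Pi.single i 1)) y (Pi.single i 1)) :=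
    fun i => ((hD i).continuous_fderiv (by norm_num)).clm_apply continuous_const
  let V : (Fin (m + 1) → ℝ) → Fin (m + 1) → ℝ := fun y i =>
    F y * slabPhi (Function.update p i (p' i)) y - slabPhi p y * fderiv ℝ F y (Pi.single i 1)
  let V' : (Fin (m + 1) → ℝ) → (Fin (m + 1) → ℝ) →L[ℝ] (Fin (m + 1) → ℝ) := fun y =>
    ContinuousLinearMap.pi fun i => fderiv ℝ (fun z => V z i) y
  have hVd : ∀ i, Differentiable ℝ (fun z => V z i) := fun i =>
    (hFd.mul (slabPhi_differentiable (hupd i))).sub ((slabPhi_differentiable hpd).mul (hDd i))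
  have hV : ∀ y, HasFDerivAt V (V' y) y := fun y =>
    hasFDerivAt_pi.2 fun i => (hVd i y).hasFDerivAt
  have hdiv : ∀ y, ∑ i, V' y (Pi.single i 1) i =
      F y * ∑ i, slabPhi (Function.update p i (p'' i)) y - slabPhi p y *
        ∑ i, fderiv ℝ (fun z => fderiv ℝ F z (Pi.single i 1)) y (Pi.single i 1) := by
    intro y
    rw [Finset.mul_sum, Finset.mul_sum, ← Finset.sum_sub_distrib]
    refine Finset.sum_congr rfl fun i _ => ?_
    have e1 : V' y (Pi.single i 1) i = fderiv ℝ (fun z => V z i) y (Pi.single i 1) := rfl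
    have h1 := (hFd y).hasFDerivAt.mul (slabPhi_differentiable (hupd i) y).hasFDerivAt
    have h2 := (slabPhi_differentiable hpd y).hasFDerivAt.mul (hDd i y).hasFDerivAt
    have h3 : HasFDerivAt (fun z => V z i) _ y := h1.sub h2
    rw [e1, h3.fderiv]
    have e2 := slabPhi_fderiv hpd i (hp i) y
    have e3 := slabPhi_fderiv (hupd i) i (g := p'' i) (by simpa using hp' i) y
    rw [Function.update_idem] at e3
    simp only [sub_apply, add_apply,
      smul_apply, smul_eq_mul, e2, e3]
    ring
  have hle : slabLo m R ≤ slabHi m R := by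
    intro i
    unfold slabLo slabHi
    split_ifs <;> linarith
  have key := integral_divergence_of_hasFDerivAt_off_countable (slabLo m R) (slabHi m R) hle V V' ∅
    countable_empty (continuous_iff_continuousAt.2 fun y => (hV y).continuousAt).continuousOn
    (fun y _ => hV y) (by
      simp only [hdiv]
      apply Continuous.integrableOn_Icc
      refine (hF.continuous.mul (continuous_finsetSum _ fun i _ => slabPhi_continuous (hupd2 i))).sub
        ((slabPhi_differentiable hpd).continuous.mul (continuous_finsetSum _ fun i _ => hDDc i)))
  have hLHS : ∫ y in Icc (slabLo m R) (slabHi m R),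
        F y * ∑ i, slabPhi (Function.update p i (p'' i)) y =
      ∫ y in Icc (slabLo m R) (slabHi m R), ∑ i, V' y (Pi.single i 1) i := by
    have hae : (Set.pi univ fun i => Ioo (slabLo m R i) (slabHi m R i)) =ᵐ[volume]
        Icc (slabLo m R) (slabHi m R) := Measure.univ_pi_Ioo_ae_eq_Icc
    rw [← setIntegral_congr_set hae, ← setIntegral_congr_set hae]
    refine setIntegral_congr_fun (MeasurableSet.univ_pi fun i => measurableSet_Ioo) fun y hy => ?_
    have hy1 := hy (Fin.last m) (mem_univ _)
    simp only [slabLo, slabHi, if_true, mem_Ioo] at hy1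
    simp only [hdiv, hharm y hy1.1 hy1.2, mul_zero, sub_zero]
  rw [hLHS, key, Finset.sum_eq_single (Fin.last m)]
  · have z1 : ∀ x : Fin m → ℝ, V ((Fin.last m).insertNth (slabHi m R (Fin.last m)) x) (Fin.last m)
        = 0 := by
      intro x
      have hy : ((Fin.last m).insertNth (slabHi m R (Fin.last m)) x : Fin (m + 1) → ℝ) (Fin.last m)
          = 2 := by simp only [Fin.insertNth_apply_same]; simp [slabHi]
      simp only [V]
      rw [hzero _ (Or.inr hy), slabPhi_eq p (Fin.last m), hy, top]
      simp
    have z2 : ∀ x : Fin m → ℝ, V ((Fin.last m).insertNth (slabLo m R (Fin.last m)) x) (Fin.last m)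
        = - (slabPhi p ((Fin.last m).insertNth 0 x) *
          fderiv ℝ F ((Fin.last m).insertNth 0 x) (Pi.single (Fin.last m) 1)) := by
      intro x
      have e : slabLo m R (Fin.last m) = 0 := by simp [slabLo]
      rw [e]
      simp only [V]
      rw [hzero _ (Or.inl (Fin.insertNth_apply_same _ _ _))]
      simp
    simp only [z1, z2, integral_neg, integral_zero]
    simp
  · intro i _ hi
    obtain ⟨s1, s2, s3, s4⟩ := side i hi
    have hz : ∀ (c : ℝ), p i c = 0 → p' i c = 0 → ∀ x : Fin m → ℝ, V (i.insertNth c x) i = 0 := by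
      intro c h1 h2 x
      have hy : (i.insertNth c x : Fin (m + 1) → ℝ) i = c := Fin.insertNth_apply_same _ _ _
      simp only [V]
      rw [slabPhi_update, slabPhi_eq p i, hy, h1, h2]
      simp
    have e1 : slabHi m R i = R := by simp [slabHi, hi]
    have e2 : slabLo m R i = -R := by simp [slabLo, hi]
    simp only [e1, e2, hz R s1 s3, hz (-R) s2 s4, integral_zero, sub_zero]
  · simp

/-- One-dimensional cutoff. -/
noncomputable def slabQ (R t : ℝ) : ℝ := (1 - (t / R) ^ 2) ^ 3
/-- Its derivative. -/
noncomputable def slabQ' (R t : ℝ) : ℝ := -6 * (t / R) * (1 - (t / R) ^ 2) ^ 2 / R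
/-- Its second derivative. -/
noncomputable def slabQ'' (R t : ℝ) : ℝ := (1 - (t / R) ^ 2) * (30 * (t / R) ^ 2 - 6) / R ^ 2

lemma slabQ_deriv {R : ℝ} (t : ℝ) : HasDerivAt (slabQ R) (slabQ' R t) t := by
  have h := (((((hasDerivAt_id t).div_const R).pow 2).const_sub 1).pow 3)
  refine HasDerivAt.congr_deriv (f := slabQ R) h ?_
  simp [slabQ']
  ring

lemma slabQ'_deriv {R : ℝ} (t : ℝ) : HasDerivAt (slabQ' R) (slabQ'' R t) t := by
  have h0 := (hasDerivAt_id t).div_const R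
  have h := (((h0.const_mul (-6)).mul (((h0.pow 2).const_sub 1).pow 2)).div_const R)
  refine HasDerivAt.congr_deriv (f := slabQ' R) h ?_
  simp [slabQ'']
  ring

lemma slabQ''_cont {R : ℝ} : Continuous (slabQ'' R) := by
  unfold slabQ''
  fun_prop

lemma slab_sq_le {R t : ℝ} (hR : 0 < R) (ht : t ∈ Icc (-R) R) : (t / R) ^ 2 ≤ 1 := by
  rw [div_pow, div_le_one (by positivity)]
  exact sq_le_sq' ht.1 ht.2

lemma slabQ_nonneg {R t : ℝ} (hR : 0 < R) (ht : t ∈ Icc (-R) R) : 0 ≤ slabQ R t := by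
  have := slab_sq_le hR ht
  unfold slabQ
  have : 0 ≤ 1 - (t / R) ^ 2 := by linarith
  positivity

lemma slabQ_le {R t : ℝ} (hR : 0 < R) (ht : t ∈ Icc (-R) R) : slabQ R t ≤ 1 := by
  have := slab_sq_le hR ht
  unfold slabQ
  exact pow_le_one₀ (by linarith) (by nlinarith [sq_nonneg (t / R)])

lemma slabQ''_ge {R t : ℝ} (hR : 0 < R) (ht : t ∈ Icc (-R) R) :
    -(6 / R ^ 2) * slabQ R t ≤ slabQ'' R t := by
  have h1 := slab_sq_le hR ht
  have h0 := sq_nonneg (t / R)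
  unfold slabQ slabQ''
  generalize (t / R) ^ 2 = s at *
  have : 0 ≤ (1 - s) * (30 * s - 6) + 6 * (1 - s) ^ 3 := by
    have : (1 - s) * (30 * s - 6) + 6 * (1 - s) ^ 3 = (1 - s) * (6 * s ^ 2 + 18 * s) := by ring
    rw [this]
    exact mul_nonneg (by linarith) (by positivity)
  have h2 : 0 ≤ ((1 - s) * (30 * s - 6) + 6 * (1 - s) ^ 3) / R ^ 2 := by positivity
  have h3 : ((1 - s) * (30 * s - 6) + 6 * (1 - s) ^ 3) / R ^ 2 =
    (1 - s) * (30 * s - 6) / R ^ 2 - -(6 / R ^ 2) * (1 - s) ^ 3 := by ring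
  linarith

lemma slabQ''_le {R t : ℝ} (hR : 0 < R) (ht : t ∈ Icc (-R) R) :
    slabQ'' R t ≤ 24 / R ^ 2 := by
  have h1 := slab_sq_le hR ht
  have h0 := sq_nonneg (t / R)
  unfold slabQ''
  generalize (t / R) ^ 2 = s at *
  gcongr
  nlinarith

lemma slabQ_half {R t : ℝ} (hR : 0 < R) (ht : t ∈ Icc (-(R / 2)) (R / 2)) :
    27 / 64 ≤ slabQ R t := by
  have h1 : (t / R) ^ 2 ≤ 1 / 4 := by
    rw [div_pow, div_le_iff₀ (by positivity)]
    nlinarith [ht.1, ht.2]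
  have h0 := sq_nonneg (t / R)
  unfold slabQ
  calc (27 / 64 : ℝ) = (3 / 4) ^ 3 := by norm_num
    _ ≤ _ := by
      apply pow_le_pow_left₀ (by norm_num)
      linarith

/-- The family of factors. -/
noncomputable def slabFam (m : ℕ) (h q : ℝ → ℝ) : Fin (m + 1) → ℝ → ℝ :=
  fun i => if i = Fin.last m then h else q

/-- The horizontal cutoff. -/
noncomputable def slabChi {m : ℕ} (R : ℝ) (y : Fin (m + 1) → ℝ) : ℝ :=
  ∏ i : Fin m, slabQ R (y i.castSucc)

lemma slabPhi_fam {m : ℕ} (h : ℝ → ℝ) (R : ℝ) (y : Fin (m + 1) → ℝ) :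
    slabPhi (slabFam m h (slabQ R)) y = h (y (Fin.last m)) * slabChi R y := by
  unfold slabPhi slabChi slabFam
  rw [Fin.prod_univ_castSucc, mul_comm]
  simp [Fin.castSucc_ne_last]

lemma slabPhi_fam_last {m : ℕ} (h g : ℝ → ℝ) (R : ℝ) (y : Fin (m + 1) → ℝ) :
    slabPhi (Function.update (slabFam m h (slabQ R)) (Fin.last m) g) y
      = g (y (Fin.last m)) * slabChi R y := by
  rw [← slabPhi_fam]
  congr 1
  funext i
  rcases eq_or_ne i (Fin.last m) with rfl | hi
  · simp [slabFam]
  · simp [slabFam, hi]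

lemma slab_mem {m : ℕ} {R : ℝ} {y : Fin (m + 1) → ℝ} (hy : y ∈ Icc (slabLo m R) (slabHi m R)) :
    y (Fin.last m) ∈ Icc (0 : ℝ) 2 ∧ ∀ i : Fin m, y i.castSucc ∈ Icc (-R) R := by
  refine ⟨⟨?_, ?_⟩, fun i => ⟨?_, ?_⟩⟩
  · simpa [slabLo] using hy.1 (Fin.last m)
  · simpa [slabHi] using hy.2 (Fin.last m)
  · simpa [slabLo, Fin.castSucc_ne_last] using hy.1 i.castSucc
  · simpa [slabHi, Fin.castSucc_ne_last] using hy.2 i.castSucc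

lemma slabChi_nonneg {m : ℕ} {R : ℝ} (hR : 0 < R) {y : Fin (m + 1) → ℝ}
    (hy : ∀ i : Fin m, y i.castSucc ∈ Icc (-R) R) : 0 ≤ slabChi R y :=
  Finset.prod_nonneg fun i _ => slabQ_nonneg hR (hy i)

lemma slabChi_le {m : ℕ} {R : ℝ} (hR : 0 < R) {y : Fin (m + 1) → ℝ}
    (hy : ∀ i : Fin m, y i.castSucc ∈ Icc (-R) R) : slabChi R y ≤ 1 :=
  Finset.prod_le_one (fun i _ => slabQ_nonneg hR (hy i)) fun i _ => slabQ_le hR (hy i)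

lemma slabChi_half {m : ℕ} {R : ℝ} (hR : 0 < R) {y : Fin (m + 1) → ℝ}
    (hy : ∀ i : Fin m, y i.castSucc ∈ Icc (-(R / 2)) (R / 2)) : (27 / 64) ^ m ≤ slabChi R y := by
  calc ((27 : ℝ) / 64) ^ m = ∏ i : Fin m, (27 / 64 : ℝ) := by
        rw [Finset.prod_const, Finset.card_univ, Fintype.card_fin]
    _ ≤ _ := Finset.prod_le_prod (fun _ _ => by norm_num) fun i _ => slabQ_half hR (hy i)

lemma slab_erase_nonneg {m : ℕ} {h : ℝ → ℝ} {R : ℝ} (hR : 0 < R) {y : Fin (m + 1) → ℝ}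
    (hh : 0 ≤ h (y (Fin.last m)))
    (hy : ∀ i : Fin m, y i.castSucc ∈ Icc (-R) R) (i : Fin (m + 1)) :
    0 ≤ ∏ j ∈ Finset.univ.erase i, slabFam m h (slabQ R) j (y j) := by
  refine Finset.prod_nonneg fun j _ => ?_
  refine Fin.lastCases ?_ (fun k => ?_) j
  · simpa [slabFam] using hh
  · simpa [slabFam, Fin.castSucc_ne_last] using slabQ_nonneg hR (hy k)

lemma slab_erase_le {m : ℕ} {h : ℝ → ℝ} {R : ℝ} (hR : 0 < R) {y : Fin (m + 1) → ℝ}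
    (hh : 0 ≤ h (y (Fin.last m))) (hh1 : h (y (Fin.last m)) ≤ 1)
    (hy : ∀ i : Fin m, y i.castSucc ∈ Icc (-R) R) (i : Fin (m + 1)) :
    ∏ j ∈ Finset.univ.erase i, slabFam m h (slabQ R) j (y j) ≤ 1 := by
  refine Finset.prod_le_one (fun j _ => ?_) fun j _ => ?_
  · refine Fin.lastCases ?_ (fun k => ?_) j
    · simpa [slabFam] using hh
    · simpa [slabFam, Fin.castSucc_ne_last] using slabQ_nonneg hR (hy k)
  · refine Fin.lastCases ?_ (fun k => ?_) j
    · simpa [slabFam] using hh1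
    · simpa [slabFam, Fin.castSucc_ne_last] using slabQ_le hR (hy k)

lemma slab_sum_ge {m : ℕ} {h h'' : ℝ → ℝ} {R : ℝ} (hR : 0 < R) {y : Fin (m + 1) → ℝ}
    (hh : 0 ≤ h (y (Fin.last m)))
    (hy : ∀ i : Fin m, y i.castSucc ∈ Icc (-R) R) :
    (h'' (y (Fin.last m)) - m * (6 / R ^ 2) * h (y (Fin.last m))) * slabChi R y ≤
      ∑ i, slabPhi (Function.update (slabFam m h (slabQ R)) i
        (slabFam m h'' (slabQ'' R) i)) y := by
  rw [Fin.sum_univ_castSucc]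
  have e1 : slabFam m h'' (slabQ'' R) (Fin.last m) = h'' := by simp [slabFam]
  rw [e1, slabPhi_fam_last]
  have h1 : ∀ i : Fin m, -(6 / R ^ 2) * (h (y (Fin.last m)) * slabChi R y) ≤
      slabPhi (Function.update (slabFam m h (slabQ R)) i.castSucc
        (slabFam m h'' (slabQ'' R) i.castSucc)) y := by
    intro i
    rw [← slabPhi_fam, slabPhi_update, slabPhi_eq _ i.castSucc, ← mul_assoc]
    refine mul_le_mul_of_nonneg_right ?_ (slab_erase_nonneg hR hh hy _)
    simpa [slabFam, Fin.castSucc_ne_last] using slabQ''_ge hR (hy i)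
  have h2 := Finset.sum_le_sum fun (i : Fin m) (_ : i ∈ Finset.univ) => h1 i
  simp only [Finset.sum_const, Finset.card_univ, Fintype.card_fin, nsmul_eq_mul] at h2
  linarith

lemma slab_sum_le {m : ℕ} {h h'' : ℝ → ℝ} {R : ℝ} (hR : 0 < R) {y : Fin (m + 1) → ℝ}
    (hh : 0 ≤ h (y (Fin.last m))) (hh1 : h (y (Fin.last m)) ≤ 1)
    (hy : ∀ i : Fin m, y i.castSucc ∈ Icc (-R) R) :
      ∑ i, slabPhi (Function.update (slabFam m h (slabQ R)) i
        (slabFam m h'' (slabQ'' R) i)) y ≤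
      m * (24 / R ^ 2) + h'' (y (Fin.last m)) * slabChi R y := by
  rw [Fin.sum_univ_castSucc]
  have e1 : slabFam m h'' (slabQ'' R) (Fin.last m) = h'' := by simp [slabFam]
  rw [e1, slabPhi_fam_last]
  have h1 : ∀ i : Fin m, 
      slabPhi (Function.update (slabFam m h (slabQ R)) i.castSucc
        (slabFam m h'' (slabQ'' R) i.castSucc)) y ≤ 24 / R ^ 2 := by
    intro i
    rw [slabPhi_update]
    have e : slabFam m h'' (slabQ'' R) i.castSucc = slabQ'' R := by
      simp [slabFam, Fin.castSucc_ne_last]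
    rw [e]
    have a := slab_erase_nonneg hR hh hy i.castSucc
    have b := slab_erase_le hR hh hh1 hy i.castSucc
    calc _ ≤ (24 / R ^ 2) * ∏ j ∈ Finset.univ.erase i.castSucc, slabFam m h (slabQ R) j (y j) :=
          mul_le_mul_of_nonneg_right (slabQ''_le hR (hy i)) a
      _ ≤ (24 / R ^ 2) * 1 := mul_le_mul_of_nonneg_left b (by positivity)
      _ = _ := mul_one _
  have h2 := Finset.sum_le_sum fun (i : Fin m) (_ : i ∈ Finset.univ) => h1 i
  simp only [Finset.sum_const, Finset.card_univ, Fintype.card_fin, nsmul_eq_mul] at h2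
  linarith

lemma slab_green_fam {m : ℕ} {F : (Fin (m + 1) → ℝ) → ℝ} (hF : ContDiff ℝ 2 F)
    (hharm : ∀ y : Fin (m + 1) → ℝ, 0 < y (Fin.last m) → y (Fin.last m) < 2 →
      ∑ i, fderiv ℝ (fun z => fderiv ℝ F z (Pi.single i 1)) y (Pi.single i 1) = 0)
    (hzero : ∀ y : Fin (m + 1) → ℝ, y (Fin.last m) = 0 ∨ y (Fin.last m) = 2 → F y = 0)
    {h h' h'' : ℝ → ℝ} (hh : ∀ t, HasDerivAt h (h' t) t)
    (hh' : ∀ t, HasDerivAt h' (h'' t) t) (hc : Continuous h'')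
    {R : ℝ} (hR : 0 < R) (top : h 2 = 0) :
    ∫ y in Icc (slabLo m R) (slabHi m R), F y * ∑ i, slabPhi (Function.update
        (slabFam m h (slabQ R)) i (slabFam m h'' (slabQ'' R) i)) y =
      ∫ x in Icc (slabLo m R ∘ (Fin.last m).succAbove) (slabHi m R ∘ (Fin.last m).succAbove),
        slabPhi (slabFam m h (slabQ R)) ((Fin.last m).insertNth 0 x) *
          fderiv ℝ F ((Fin.last m).insertNth 0 x) (Pi.single (Fin.last m) 1) := by
  refine slab_green hF hharm hzero (p' := slabFam m h' (slabQ' R)) ?_ ?_ ?_ hR ?_ ?_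
  · intro i t
    unfold slabFam
    split_ifs
    exacts [hh t, slabQ_deriv t]
  · intro i t
    unfold slabFam
    split_ifs
    exacts [hh' t, slabQ'_deriv t]
  · intro i
    unfold slabFam
    split_ifs
    exacts [hc, slabQ''_cont]
  · intro i hi
    simp [slabFam, hi, slabQ, slabQ', hR.ne']
  · simpa [slabFam] using top

lemma slab_fam_cont {m : ℕ} {h h'' : ℝ → ℝ} (hh : Continuous h) (hc : Continuous h'') (R : ℝ) :
    Continuous fun y : Fin (m + 1) → ℝ => ∑ i, slabPhi (Function.update
        (slabFam m h (slabQ R)) i (slabFam m h'' (slabQ'' R) i)) y := by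
  refine continuous_finsetSum _ fun i _ => slabPhi_continuous fun j => ?_
  have h2 : Continuous (slabQ R) := by
    unfold slabQ
    fun_prop
  rcases eq_or_ne j i with rfl | hj
  · rw [Function.update_self]
    unfold slabFam
    split_ifs
    exacts [hc, slabQ''_cont]
  · rw [Function.update_of_ne hj]
    unfold slabFam
    split_ifs
    exacts [hh, h2]

lemma slabChi_cont {m : ℕ} (R : ℝ) : Continuous (slabChi (m := m) R) := by
  unfold slabChi slabQ
  fun_prop

/-- First step: the gradient bound gives polynomial growth. -/
lemma slab_step1 {m : ℕ} {F : (Fin (m + 1) → ℝ) → ℝ} (hF : ContDiff ℝ 2 F)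
    (hharm : ∀ y : Fin (m + 1) → ℝ, 0 < y (Fin.last m) → y (Fin.last m) < 2 →
      ∑ i, fderiv ℝ (fun z => fderiv ℝ F z (Pi.single i 1)) y (Pi.single i 1) = 0)
    (hnonneg : ∀ y : Fin (m + 1) → ℝ, 0 ≤ y (Fin.last m) → y (Fin.last m) ≤ 2 → 0 ≤ F y)
    (hzero : ∀ y : Fin (m + 1) → ℝ, y (Fin.last m) = 0 ∨ y (Fin.last m) = 2 → F y = 0)
    {C : ℝ} (hC : ∀ y : Fin (m + 1) → ℝ, y (Fin.last m) = 0 →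
      |fderiv ℝ F y (Pi.single (Fin.last m) 1)| ≤ C)
    {R : ℝ} (hR : 0 < R) (hR2 : 24 * m ≤ R ^ 2) :
    ∫ y in Icc (slabLo m R) (slabHi m R), F y * slabChi R y ≤ 4 * C * (2 * R) ^ m := by
  have g := slab_green_fam hF hharm hzero (h := fun t => (2 - t) ^ 2) (h' := fun t => -2 * (2 - t))
    (h'' := fun _ => 2)
    (fun t => by
      refine HasDerivAt.congr_deriv (((hasDerivAt_id t).const_sub 2).pow 2) ?_
      simp)
    (fun t => by
      refine HasDerivAt.congr_deriv (((hasDerivAt_id t).const_sub 2).const_mul (-2)) ?_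
      simp)
    continuous_const hR (by norm_num)
  have hb : |∫ x in Icc (slabLo m R ∘ (Fin.last m).succAbove) (slabHi m R ∘ (Fin.last m).succAbove),
        slabPhi (slabFam m (fun t => (2 - t) ^ 2) (slabQ R)) ((Fin.last m).insertNth 0 x) *
          fderiv ℝ F ((Fin.last m).insertNth 0 x) (Pi.single (Fin.last m) 1)| ≤
      4 * C * (2 * R) ^ m := by
    have hfin : volume (Icc (slabLo m R ∘ (Fin.last m).succAbove)
        (slabHi m R ∘ (Fin.last m).succAbove)) < ⊤ := isCompact_Icc.measure_lt_top
    have hvol : volume.real (Icc (slabLo m R ∘ (Fin.last m).succAbove)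
        (slabHi m R ∘ (Fin.last m).succAbove)) = (2 * R) ^ m := by
      rw [Measure.real, Real.volume_Icc_pi]
      simp [slabLo, slabHi, Fin.castSucc_ne_last]
      rw [ENNReal.toReal_ofReal (by linarith)]
      ring
    rw [← hvol, ← Real.norm_eq_abs]
    refine norm_setIntegral_le_of_norm_le_const hfin fun x hx => ?_
    have hl : ((Fin.last m).insertNth 0 x : Fin (m + 1) → ℝ) (Fin.last m) = 0 :=
      Fin.insertNth_apply_same _ _ _
    have hcs : ∀ i : Fin m, ((Fin.last m).insertNth 0 x : Fin (m + 1) → ℝ) i.castSucc ∈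
        Icc (-R) R := by
      intro i
      have e : ((Fin.last m).insertNth 0 x : Fin (m + 1) → ℝ) i.castSucc = x i := by
        simp [Fin.insertNth_last']
      rw [e]
      have h1 := hx.1 i
      have h2 := hx.2 i
      simp [slabLo, slabHi, Fin.castSucc_ne_last] at h1 h2
      exact ⟨h1, h2⟩
    rw [slabPhi_fam, hl, norm_mul, Real.norm_eq_abs, Real.norm_eq_abs]
    have a := slabChi_nonneg hR hcs
    have b := slabChi_le hR hcs
    refine mul_le_mul ?_ (hC _ hl) (abs_nonneg _) (by norm_num)
    rw [abs_of_nonneg (by positivity)]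
    linarith
  rw [← g] at hb
  refine le_trans ?_ ((le_abs_self _).trans hb)
  refine setIntegral_mono_on (Continuous.integrableOn_Icc ?_) (Continuous.integrableOn_Icc ?_)
    measurableSet_Icc fun y hy => ?_
  · exact hF.continuous.mul (slabChi_cont R)
  · exact hF.continuous.mul (slab_fam_cont (by fun_prop) (by fun_prop) R)
  · obtain ⟨⟨h1, h2⟩, h3⟩ := slab_mem hy
    refine mul_le_mul_of_nonneg_left ?_ (hnonneg y h1 h2)
    refine le_trans ?_ (slab_sum_ge hR (by positivity) h3)
    have h4 : (m : ℝ) * (6 / R ^ 2) ≤ 1 / 4 := by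
      rw [← mul_div_assoc, div_le_iff₀ (by positivity)]
      linarith
    have h5 : (2 - y (Fin.last m)) ^ 2 ≤ 4 := by nlinarith
    have h6 : (m : ℝ) * (6 / R ^ 2) * (2 - y (Fin.last m)) ^ 2 ≤ 1 / 4 * 4 :=
      mul_le_mul h4 h5 (by positivity) (by norm_num)
    exact le_mul_of_one_le_left (slabChi_nonneg hR h3) (by linarith)

/-- Second step: the Caccioppoli-type decay. -/
lemma slab_step2 {m : ℕ} {F : (Fin (m + 1) → ℝ) → ℝ} (hF : ContDiff ℝ 2 F)
    (hharm : ∀ y : Fin (m + 1) → ℝ, 0 < y (Fin.last m) → y (Fin.last m) < 2 →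
      ∑ i, fderiv ℝ (fun z => fderiv ℝ F z (Pi.single i 1)) y (Pi.single i 1) = 0)
    (hnonneg : ∀ y : Fin (m + 1) → ℝ, 0 ≤ y (Fin.last m) → y (Fin.last m) ≤ 2 → 0 ≤ F y)
    (hzero : ∀ y : Fin (m + 1) → ℝ, y (Fin.last m) = 0 ∨ y (Fin.last m) = 2 → F y = 0)
    {R : ℝ} (hR : 0 < R) :
    2 * ∫ y in Icc (slabLo m R) (slabHi m R), F y * slabChi R y ≤
      m * (24 / R ^ 2) * ∫ y in Icc (slabLo m R) (slabHi m R), F y := by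
  have g := slab_green_fam hF hharm hzero (h := fun t => t * (2 - t)) (h' := fun t => 2 - 2 * t)
    (h'' := fun _ => -2)
    (fun t => by
      refine HasDerivAt.congr_deriv ((hasDerivAt_id t).mul ((hasDerivAt_id t).const_sub 2)) ?_
      simp
      ring)
    (fun t => by
      refine HasDerivAt.congr_deriv (((hasDerivAt_id t).const_mul 2).const_sub 2) ?_
      simp)
    continuous_const hR (by norm_num)
  have hz : ∀ x : Fin m → ℝ, slabPhi (slabFam m (fun t => t * (2 - t)) (slabQ R))
      ((Fin.last m).insertNth 0 x) = 0 := by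
    intro x
    have hl : ((Fin.last m).insertNth 0 x : Fin (m + 1) → ℝ) (Fin.last m) = 0 :=
      Fin.insertNth_apply_same _ _ _
    rw [slabPhi_fam, hl]
    simp
  simp only [hz, zero_mul, integral_zero] at g
  have i1 : IntegrableOn (fun y => F y * slabChi R y) (Icc (slabLo m R) (slabHi m R)) :=
    (hF.continuous.mul (slabChi_cont R)).integrableOn_Icc
  have i2 : IntegrableOn F (Icc (slabLo m R) (slabHi m R)) := hF.continuous.integrableOn_Icc
  rw [← sub_nonneg, ← integral_const_mul, ← integral_const_mul,
    ← integral_sub (i2.const_mul _) (i1.const_mul _), ← g]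
  refine setIntegral_mono_on (Continuous.integrableOn_Icc ?_)
    ((i2.const_mul _).sub (i1.const_mul _)) measurableSet_Icc fun y hy => ?_
  · exact hF.continuous.mul (slab_fam_cont (by fun_prop) (by fun_prop) R)
  · obtain ⟨⟨h1, h2⟩, h3⟩ := slab_mem hy
    have h4 := slab_sum_le (h := fun t => t * (2 - t)) (h'' := fun _ => -2) hR
      (mul_nonneg h1 (by linarith)) (by nlinarith [sq_nonneg (y (Fin.last m) - 1)]) h3
    have h5 := mul_le_mul_of_nonneg_left h4 (hnonneg y h1 h2)
    refine h5.trans (le_of_eq ?_)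
    ring

lemma slab_half {m : ℕ} {F : (Fin (m + 1) → ℝ) → ℝ} (hF : Continuous F)
    (hnonneg : ∀ y : Fin (m + 1) → ℝ, 0 ≤ y (Fin.last m) → y (Fin.last m) ≤ 2 → 0 ≤ F y)
    {R : ℝ} (hR : 0 < R) :
    (27 / 64) ^ m * ∫ y in Icc (slabLo m (R / 2)) (slabHi m (R / 2)), F y ≤
      ∫ y in Icc (slabLo m R) (slabHi m R), F y * slabChi R y := by
  have i1 : IntegrableOn (fun y => F y * slabChi R y) (Icc (slabLo m R) (slabHi m R)) :=
    (hF.mul (slabChi_cont R)).integrableOn_Icc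
  have i2 : IntegrableOn F (Icc (slabLo m (R / 2)) (slabHi m (R / 2))) := hF.integrableOn_Icc
  have hsub : Icc (slabLo m (R / 2)) (slabHi m (R / 2)) ⊆ Icc (slabLo m R) (slabHi m R) := by
    apply Icc_subset_Icc
    · intro i
      unfold slabLo
      split_ifs <;> linarith
    · intro i
      unfold slabHi
      split_ifs <;> linarith
  calc _ = ∫ y in Icc (slabLo m (R / 2)) (slabHi m (R / 2)), (27 / 64) ^ m * F y :=
        (integral_const_mul _ _).symm
    _ ≤ ∫ y in Icc (slabLo m (R / 2)) (slabHi m (R / 2)), F y * slabChi R y := by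
        refine setIntegral_mono_on (i2.const_mul _) (i1.mono_set hsub) measurableSet_Icc
          fun y hy => ?_
        obtain ⟨⟨h1, h2⟩, h3⟩ := slab_mem hy
        rw [mul_comm]
        exact mul_le_mul_of_nonneg_left (slabChi_half hR h3) (hnonneg y h1 h2)
    _ ≤ _ := by
        refine setIntegral_mono_set i1 ?_ hsub.eventuallyLE
        refine (ae_restrict_iff' measurableSet_Icc).2 (Filter.Eventually.of_forall fun y hy => ?_)
        obtain ⟨⟨h1, h2⟩, h3⟩ := slab_mem hy
        exact mul_nonneg (hnonneg y h1 h2) (slabChi_nonneg hR h3)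

/-- The real-variable iteration. -/
lemma slab_iter {m : ℕ} (hm : 1 ≤ m) {A : ℝ → ℝ} (h0 : ∀ R, 0 < R → 0 ≤ A R)
    (hmono : ∀ r R, 0 < r → r ≤ R → A r ≤ A R) {K L R0 : ℝ} (hL : 0 ≤ L) 
    (h1 : ∀ R, 0 < R → R0 ≤ R → A R ≤ K * R ^ m)
    (h2 : ∀ R, 0 < R → A R * R ^ 2 ≤ L * A (2 * R)) : ∀ R, 0 < R → A R = 0 := by
  have hk : ∀ k : ℕ, ∃ C, ∀ R, 0 < R → R0 ≤ R → A R * R ^ (2 * k) ≤ C * R ^ m := by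
    intro k
    induction k with
    | zero => exact ⟨K, by simpa using h1⟩
    | succ k ih =>
      obtain ⟨C, hC⟩ := ih
      refine ⟨L * (C * 2 ^ m), fun R hR hR0 => ?_⟩
      have a := hC (2 * R) (by linarith) (by linarith)
      have b := h2 R hR
      have c : A (2 * R) * R ^ (2 * k) ≤ A (2 * R) * (2 * R) ^ (2 * k) :=
        mul_le_mul_of_nonneg_left (pow_le_pow_left₀ hR.le (by linarith) _) (h0 _ (by linarith))
      calc A R * R ^ (2 * (k + 1)) = A R * R ^ 2 * R ^ (2 * k) := by ring
        _ ≤ L * A (2 * R) * R ^ (2 * k) := mul_le_mul_of_nonneg_right b (by positivity)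
        _ = L * (A (2 * R) * R ^ (2 * k)) := by ring
        _ ≤ L * (C * (2 * R) ^ m) := mul_le_mul_of_nonneg_left (c.trans a) hL
        _ = _ := by rw [mul_pow]; ring
  obtain ⟨C, hC⟩ := hk m
  intro R hR
  by_contra hne
  have hpos : 0 < A R := lt_of_le_of_ne (h0 R hR) (Ne.symm hne)
  let S := max (max R R0) (max 1 ((C + 1) / A R))
  have hSR : R ≤ S := (le_max_left _ _).trans (le_max_left _ _)
  have hS0 : R0 ≤ S := (le_max_right _ _).trans (le_max_left _ _)
  have hS1 : 1 ≤ S := (le_max_left _ _).trans (le_max_right _ _)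
  have hS2 : (C + 1) / A R ≤ S := (le_max_right _ _).trans (le_max_right _ _)
  have hSpos : 0 < S := by linarith
  have a := hC S hSpos hS0
  have b := hmono R S hR hSR
  have c : A S * S ^ m ≤ C := by
    have : 0 < S ^ m := by positivity
    refine le_of_mul_le_mul_right ?_ this
    calc _ = A S * S ^ (2 * m) := by ring
      _ ≤ _ := a
  have d : S ≤ S ^ m := le_self_pow₀ hS1 (by omega)
  rw [div_le_iff₀ hpos] at hS2
  have e : S * A R ≤ S ^ m * A S := mul_le_mul d b hpos.le (by positivity)
  linarith

lemma slab_liouville {m : ℕ} (hm : 1 ≤ m) {F : (Fin (m + 1) → ℝ) → ℝ} (hF : ContDiff ℝ 2 F)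
    (hharm : ∀ y : Fin (m + 1) → ℝ, 0 < y (Fin.last m) → y (Fin.last m) < 2 →
      ∑ i, fderiv ℝ (fun z => fderiv ℝ F z (Pi.single i 1)) y (Pi.single i 1) = 0)
    (hnonneg : ∀ y : Fin (m + 1) → ℝ, 0 ≤ y (Fin.last m) → y (Fin.last m) ≤ 2 → 0 ≤ F y)
    (hzero : ∀ y : Fin (m + 1) → ℝ, y (Fin.last m) = 0 ∨ y (Fin.last m) = 2 → F y = 0)
    {C : ℝ} (hC : ∀ y : Fin (m + 1) → ℝ, y (Fin.last m) = 0 →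
      |fderiv ℝ F y (Pi.single (Fin.last m) 1)| ≤ C)
    (y : Fin (m + 1) → ℝ) (hy0 : 0 ≤ y (Fin.last m)) (hy2 : y (Fin.last m) ≤ 2) : F y = 0 := by
  have hnn : ∀ R, 0 ≤ᵐ[volume.restrict (Icc (slabLo m R) (slabHi m R))] F := fun R => by
    refine (ae_restrict_iff' measurableSet_Icc).2 (Filter.Eventually.of_forall fun y hy => ?_)
    obtain ⟨⟨h1, h2⟩, h3⟩ := slab_mem hy
    exact hnonneg y h1 h2
  have hFint : ∀ R, IntegrableOn F (Icc (slabLo m R) (slabHi m R)) := fun R =>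
    hF.continuous.integrableOn_Icc
  have hA := slab_iter hm (A := fun R => ∫ y in Icc (slabLo m R) (slabHi m R), F y)
    (K := (64 / 27) ^ m * (4 * C * 4 ^ m)) (L := (64 / 27) ^ m * (m * 3)) (R0 := 24 * m)
    (fun R _ => integral_nonneg_of_ae (hnn R))
    (fun r R hr hrR => by
      refine setIntegral_mono_set (hFint R) (hnn R) (LE.le.eventuallyLE ?_)
      apply Icc_subset_Icc
      · intro i
        unfold slabLo
        split_ifs <;> linarith
      · intro i
        unfold slabHi
        split_ifs <;> linarith)
    (by positivity)
    (fun R hR hR0 => by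
      have hm' : (1 : ℝ) ≤ m := by exact_mod_cast hm
      have a := slab_half hF.continuous hnonneg (R := 2 * R) (by linarith)
      have b := slab_step1 hF hharm hnonneg hzero hC (R := 2 * R) (by linarith) (by nlinarith)
      rw [show 2 * R / 2 = R by ring] at a
      have c := mul_le_mul_of_nonneg_left (a.trans b) (show (0 : ℝ) ≤ (64 / 27) ^ m by positivity)
      rw [← mul_assoc, ← mul_pow] at c
      norm_num at c
      refine c.trans (le_of_eq ?_)
      rw [← mul_assoc 2 2 R, mul_pow]
      norm_num
      ring)
    (fun R hR => by
      have a := slab_half hF.continuous hnonneg (R := 2 * R) (by linarith)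
      have b := slab_step2 hF hharm hnonneg hzero (R := 2 * R) (by linarith)
      rw [show 2 * R / 2 = R by ring] at a
      have c := mul_le_mul_of_nonneg_left a (show (0 : ℝ) ≤ (64 / 27) ^ m by positivity)
      rw [← mul_assoc, ← mul_pow] at c
      norm_num at c
      set I1 := ∫ y in Icc (slabLo m (2 * R)) (slabHi m (2 * R)), F y
      set I2 := ∫ y in Icc (slabLo m (2 * R)) (slabHi m (2 * R)), F y * slabChi (2 * R) y
      have d : I2 * R ^ 2 ≤ m * 3 * I1 := by
        have := mul_le_mul_of_nonneg_right b (show 0 ≤ R ^ 2 / 2 by positivity)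
        field_simp at this
        linarith
      have e := mul_le_mul_of_nonneg_right c (show 0 ≤ R ^ 2 by positivity)
      have f := mul_le_mul_of_nonneg_left d (show (0 : ℝ) ≤ (64 / 27) ^ m by positivity)
      refine e.trans ?_
      linarith)
  by_cases hb : y (Fin.last m) = 0 ∨ y (Fin.last m) = 2
  · exact hzero y hb
  push Not at hb
  let R := ‖y‖ + 1
  have hR : 0 < R := by positivity
  have hAR : ∫ y in Icc (slabLo m R) (slabHi m R), F y = 0 := hA R hR
  rw [setIntegral_eq_zero_iff_of_nonneg_ae (hnn R) (hFint R)] at hAR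
  have hae : (Set.pi univ fun i => Ioo (slabLo m R i) (slabHi m R i)) ⊆
      Icc (slabLo m R) (slabHi m R) := fun z hz =>
    ⟨fun i => (hz i (mem_univ _)).1.le, fun i => (hz i (mem_univ _)).2.le⟩
  have h3 := ae_restrict_of_ae_restrict_of_subset hae hAR
  have h4 := Measure.eqOn_open_of_ae_eq h3 (isOpen_set_pi finite_univ fun i _ => isOpen_Ioo)
    hF.continuous.continuousOn continuousOn_const
  refine h4 fun i _ => ?_
  have hn := abs_le.1 ((Real.norm_eq_abs _).symm.le.trans (norm_le_pi_norm y i))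
  unfold slabLo slabHi
  beta_reduce
  split_ifs with hi
  · subst hi
    exact ⟨lt_of_le_of_ne hy0 (Ne.symm hb.1), lt_of_le_of_ne hy2 hb.2⟩
  · constructor <;> simp only [R] <;> linarith [hn.1, hn.2]

/-- **Liouville theorem on the slab** (Lemma E.1). A smooth non-negative function on the slab
`{0 ≤ xₙ ≤ 2}` that is harmonic in the interior, vanishes on the two boundary hyperplanes, and
whose gradient is bounded on `{xₙ = 0}`, vanishes identically on the slab. -/
theorem liouville_on_slab (n : ℕ) (hn : 2 ≤ n) (f : EuclideanSpace ℝ (Fin n) → ℝ)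
    (hsmooth : ContDiff ℝ (⊤ : ℕ∞) f)
    (hharm : ∀ x : EuclideanSpace ℝ (Fin n),
      0 < x ⟨n - 1, by omega⟩ → x ⟨n - 1, by omega⟩ < 2 → laplacian f x = 0)
    (hnonneg : ∀ x : EuclideanSpace ℝ (Fin n),
      0 ≤ x ⟨n - 1, by omega⟩ → x ⟨n - 1, by omega⟩ ≤ 2 → 0 ≤ f x)
    (hzero : ∀ x : EuclideanSpace ℝ (Fin n),
      x ⟨n - 1, by omega⟩ = 0 ∨ x ⟨n - 1, by omega⟩ = 2 → f x = 0)
    (hgrad : ∃ Cb : ℝ, ∀ x : EuclideanSpace ℝ (Fin n),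
      x ⟨n - 1, by omega⟩ = 0 → ‖gradient f x‖ ≤ Cb) :
    ∀ x : EuclideanSpace ℝ (Fin n),
      0 ≤ x ⟨n - 1, by omega⟩ → x ⟨n - 1, by omega⟩ ≤ 2 → f x = 0 := by
  obtain ⟨m, rfl⟩ : ∃ m, n = m + 1 := ⟨n - 1, by omega⟩
  have hlast : (⟨m + 1 - 1, by omega⟩ : Fin (m + 1)) = Fin.last m := by
    ext
    simp
  simp only [hlast] at hharm hnonneg hzero hgrad ⊢
  obtain ⟨C, hC⟩ := hgrad
  have hfd : ∀ (g : EuclideanSpace ℝ (Fin (m + 1)) → ℝ) (y : Fin (m + 1) → ℝ) (i : Fin (m + 1)),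
      fderiv ℝ (fun z : Fin (m + 1) → ℝ => g (WithLp.toLp 2 z)) y (Pi.single i 1) =
        fderiv ℝ g (WithLp.toLp 2 y) (EuclideanSpace.single i 1) := by
    intro g y i
    have := (PiLp.continuousLinearEquiv 2 ℝ (fun _ : Fin (m + 1) => ℝ)).symm.comp_right_fderiv
      (f := g) (x := y)
    exact congrArg (fun L => L (Pi.single i 1)) this
  have hF : ContDiff ℝ 2 (fun z : Fin (m + 1) → ℝ => f (WithLp.toLp 2 z)) :=
    (contDiff_infty.1 hsmooth 2).comp
      (PiLp.continuousLinearEquiv 2 ℝ (fun _ : Fin (m + 1) => ℝ)).symm.contDiff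
  intro x hx0 hx2
  refine slab_liouville (by omega) hF ?_ (fun y => hnonneg (WithLp.toLp 2 y))
    (fun y => hzero (WithLp.toLp 2 y)) (C := C) ?_ (WithLp.ofLp x) hx0 hx2
  · intro y h0 h2
    have := hharm (WithLp.toLp 2 y) h0 h2
    unfold laplacian at this
    rw [← this]
    refine Finset.sum_congr rfl fun i _ => ?_
    simp only [hfd]
    exact hfd (fun w => fderiv ℝ f w (EuclideanSpace.single i 1)) y i
  · intro y hy
    rw [hfd]
    have h1 := hC (WithLp.toLp 2 y) hy
    have h2 : ‖gradient f (WithLp.toLp 2 y)‖ = ‖fderiv ℝ f (WithLp.toLp 2 y)‖ := by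
      simp [gradient]
    rw [h2] at h1
    have h3 := (fderiv ℝ f (WithLp.toLp 2 y)).le_opNorm (EuclideanSpace.single (Fin.last m) 1)
    rw [← Real.norm_eq_abs]
    refine h3.trans ?_
    simpa using h1
end

section
/- Let n ≥ 2 be an integer, let δ ∈ (0,1) and τ > 0, and let η : ℝ → ℝ be continuously differentiable with 0 ≤ η(t) ≤ 1 for all t, η(t) = 0 for t ≤ 1/2, and η′(t) ≥ 0 for all t. Define F : ℝⁿ → ℝ by F(x) = 1 − (1−δ)·η(xₙ·(1 + ρ(x)²)^{−1/2})·(1 + δ|x|²)^{−τ/2}, where ρ(x)² = x₁² + ⋯ + x_{n−1}². Then: (i) δ ≤ F(x) ≤ 1 for all x ∈ ℝⁿ; (ii) F(x) = 1 whenever xₙ ≤ 0; and (iii) Σ_{i=1}^{n−1} xᵢ·(∂F/∂xᵢ)(x) ≥ 0 for every x ∈ ℝⁿ. -/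
open MeasureTheory Set Real

/-- The conformal factor `F` from the proof of Lemma 7.2: with a cutoff `η` and `δ ∈ (0,1)`,
`τ > 0`, the function `F(x) = 1 - (1-δ) η(xₙ (1+ρ(x)²)^(-1/2)) (1+δ|x|²)^(-τ/2)` satisfies
`δ ≤ F ≤ 1`, `F = 1` on the lower half-space `{xₙ ≤ 0}`, and the radial monotonicity
`Σ_{i=1}^{n-1} xᵢ ∂F/∂xᵢ ≥ 0`. -/
theorem conformal_factor_properties (n : ℕ) (hn : 2 ≤ n) (δ τ : ℝ)
    (hδ : δ ∈ Set.Ioo (0 : ℝ) 1) (hτ : 0 < τ) (η : ℝ → ℝ) (hη : ContDiff ℝ 1 η)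
    (hη01 : ∀ t : ℝ, 0 ≤ η t ∧ η t ≤ 1) (hη0 : ∀ t : ℝ, t ≤ 1 / 2 → η t = 0)
    (hη' : ∀ t : ℝ, 0 ≤ deriv η t) :
    let ρ2 : EuclideanSpace ℝ (Fin n) → ℝ :=
      fun x => ∑ i : Fin (n - 1), x (Fin.castLE (Nat.sub_le n 1) i) ^ 2
    let F : EuclideanSpace ℝ (Fin n) → ℝ :=
      fun x => 1 - (1 - δ) * η (x ⟨n - 1, by omega⟩ * (1 + ρ2 x) ^ (-(1 : ℝ) / 2))
        * (1 + δ * ‖x‖ ^ 2) ^ (-τ / 2)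
    (∀ x : EuclideanSpace ℝ (Fin n), δ ≤ F x ∧ F x ≤ 1) ∧
    (∀ x : EuclideanSpace ℝ (Fin n), x ⟨n - 1, by omega⟩ ≤ 0 → F x = 1) ∧
    (∀ x : EuclideanSpace ℝ (Fin n),
      0 ≤ ∑ i : Fin (n - 1), x (Fin.castLE (Nat.sub_le n 1) i) *
        fderiv ℝ F x (EuclideanSpace.single (Fin.castLE (Nat.sub_le n 1) i) 1)) := by
  obtain ⟨hδ0, hδ1⟩ := hδ
  intro ρ2 F
  have hρ : ∀ x, 0 ≤ ρ2 x := fun x => Finset.sum_nonneg fun i _ => sq_nonneg _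
  have hmono : Monotone η := monotone_of_deriv_nonneg (hη.differentiable (by norm_num)) hη'
  have hB1 : ∀ x : EuclideanSpace ℝ (Fin n), 1 ≤ 1 + δ * ‖x‖ ^ 2 := fun x => by
    have : 0 ≤ δ * ‖x‖ ^ 2 := by positivity
    linarith
  have hB0 : ∀ x : EuclideanSpace ℝ (Fin n), 0 ≤ (1 + δ * ‖x‖ ^ 2) ^ (-τ / 2) := fun x =>
    Real.rpow_nonneg (by linarith [hB1 x]) _
  have hBle : ∀ x : EuclideanSpace ℝ (Fin n), (1 + δ * ‖x‖ ^ 2) ^ (-τ / 2) ≤ 1 := fun x =>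
    Real.rpow_le_one_of_one_le_of_nonpos (hB1 x) (by linarith)
  have hA0 : ∀ x : EuclideanSpace ℝ (Fin n), 0 ≤ (1 + ρ2 x) ^ (-(1 : ℝ) / 2) := fun x =>
    Real.rpow_nonneg (by linarith [hρ x]) _
  have h1 : ∀ x : EuclideanSpace ℝ (Fin n), δ ≤ F x ∧ F x ≤ 1 := by
    intro x
    have hp := hη01 (x ⟨n - 1, by omega⟩ * (1 + ρ2 x) ^ (-(1 : ℝ) / 2))
    have hm := mul_le_one₀ hp.2 (hB0 x) (hBle x)
    have hm0 := mul_nonneg hp.1 (hB0 x)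
    simp only [F]
    rw [mul_assoc]
    constructor <;> nlinarith
  have h2 : ∀ x : EuclideanSpace ℝ (Fin n), x ⟨n - 1, by omega⟩ ≤ 0 → F x = 1 := by
    intro x hx
    have := mul_nonpos_of_nonpos_of_nonneg hx (hA0 x)
    simp only [F]
    rw [hη0 _ (by linarith)]
    ring
  have key : ∀ x y : EuclideanSpace ℝ (Fin n), y ⟨n - 1, by omega⟩ = x ⟨n - 1, by omega⟩ →
      (∀ i, x i ^ 2 ≤ y i ^ 2) → F x ≤ F y := by
    intro x y hl hc
    by_cases hx : x ⟨n - 1, by omega⟩ ≤ 0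
    · rw [h2 x hx, h2 y (hl ▸ hx)]
    · push Not at hx
      have hr : ρ2 x ≤ ρ2 y := Finset.sum_le_sum fun i _ => hc _
      have hn2 : ‖x‖ ^ 2 ≤ ‖y‖ ^ 2 := by
        rw [EuclideanSpace.real_norm_sq_eq, EuclideanSpace.real_norm_sq_eq]
        exact Finset.sum_le_sum fun i _ => hc _
      have hA : (1 + ρ2 y) ^ (-(1 : ℝ) / 2) ≤ (1 + ρ2 x) ^ (-(1 : ℝ) / 2) :=
        Real.rpow_le_rpow_of_nonpos (by linarith [hρ x]) (by linarith) (by norm_num)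
      have hB : (1 + δ * ‖y‖ ^ 2) ^ (-τ / 2) ≤ (1 + δ * ‖x‖ ^ 2) ^ (-τ / 2) :=
        Real.rpow_le_rpow_of_nonpos (by linarith [hB1 x]) (by nlinarith) (by linarith)
      have hE := hmono (mul_le_mul_of_nonneg_left hA hx.le)
      have := mul_le_mul hE hB (hB0 y) (hη01 _).1
      simp only [F]
      rw [hl, mul_assoc, mul_assoc]
      nlinarith
  refine ⟨h1, h2, fun x => ?_⟩
  by_cases hd : DifferentiableAt ℝ F x
  swap
  · simp [fderiv_zero_of_not_differentiableAt hd]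
  set v : EuclideanSpace ℝ (Fin n) := ∑ i : Fin (n - 1), x (Fin.castLE (Nat.sub_le n 1) i) •
    EuclideanSpace.single (Fin.castLE (Nat.sub_le n 1) i) (1 : ℝ) with hv
  have hsum : (∑ i : Fin (n - 1), x (Fin.castLE (Nat.sub_le n 1) i) *
        fderiv ℝ F x (EuclideanSpace.single (Fin.castLE (Nat.sub_le n 1) i) 1))
      = fderiv ℝ F x v := by
    simp [hv, map_sum]
  rw [hsum]
  have hvi : ∀ i, v i = x i * ∑ j : Fin (n - 1),
      if i = Fin.castLE (Nat.sub_le n 1) j then (1 : ℝ) else 0 := by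
    intro i
    rw [hv, WithLp.ofLp_sum, Finset.sum_apply, Finset.mul_sum]
    refine Finset.sum_congr rfl fun j _ => ?_
    by_cases h : i = Fin.castLE (Nat.sub_le n 1) j
    · simp [h]
    · simp [h]
  have hk : ∀ i : Fin n, 0 ≤ ∑ j : Fin (n - 1),
      if i = Fin.castLE (Nat.sub_le n 1) j then (1 : ℝ) else 0 := fun i =>
    Finset.sum_nonneg fun j _ => by split_ifs <;> norm_num
  have hvl : v ⟨n - 1, by omega⟩ = 0 := by
    rw [hvi, Finset.sum_eq_zero, mul_zero]
    intro j _
    rw [if_neg]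
    intro h
    have := congrArg Fin.val h
    simp at this
    omega
  have hmin : IsMinOn F (segment ℝ x (x + v)) x := by
    intro y hy
    rw [segment_eq_image'] at hy
    obtain ⟨s, hs, rfl⟩ := hy
    refine key _ _ ?_ ?_
    · simp [hvl]
    · intro i
      simp only [add_sub_cancel_left, PiLp.add_apply, PiLp.smul_apply, smul_eq_mul]
      rw [hvi]
      have h0 := mul_nonneg hs.1 (hk i)
      set k := ∑ j : Fin (n - 1), if i = Fin.castLE (Nat.sub_le n 1) j then (1 : ℝ) else 0
      have : (x i + s * (x i * k)) ^ 2 = x i ^ 2 + x i ^ 2 * (2 * (s * k) + (s * k) ^ 2) := by ring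
      rw [this]
      have : 0 ≤ x i ^ 2 * (2 * (s * k) + (s * k) ^ 2) := by positivity
      linarith
  exact hmin.localize.hasFDerivWithinAt_nonneg hd.hasFDerivAt.hasFDerivWithinAt
    (mem_posTangentConeAt_of_segment_subset subset_rfl)
end
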